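/- Let ⊢ Γ be a classical 𝓛_C-sequent and x a propositional variable not occurring in Γ. Then ⊢ Γ is provable in LL if and only if the intuitionistic sequent Γ^[x] ⊢ x is provable in ILL. -/

import Mathlib

namespace Affine

/-- Intuitionistic formulas: the language 𝓛 (⊗, ⊸, &, ⊕, !, 1, ⊤, ⊥, 0)
together with the extra ILAL modality §. -/
inductive IForm : Type where
  | var (n : ℕ)
  | one
  | top
  | bot
  | zero
  | tensor (A B : IForm)
  | limp (A B : IForm)
  | and (A B : IForm)
  | or (A B : IForm)
  | bang (A : IForm)
  | para (A : IForm)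

namespace IForm

/-- membership in the language 𝓛 (no §) -/
def inL : IForm → Prop
  | para _ => False
  | tensor A B => inL A ∧ inL B
  | limp A B => inL A ∧ inL B
  | and A B => inL A ∧ inL B
  | or A B => inL A ∧ inL B
  | bang A => inL A
  | _ => True

/-- membership in the ⊥-free language 𝓛⁺ -/
def inLp : IForm → Prop
  | para _ => False
  | bot => False
  | tensor A B => inLp A ∧ inLp B
  | limp A B => inLp A ∧ inLp B
  | and A B => inLp A ∧ inLp B
  | or A B => inLp A ∧ inLp B
  | bang A => inLp A
  | _ => True

/-- {⊗,⊸,&,⊕,1,⊥}-formulas -/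
def inFLei : IForm → Prop
  | var _ => True
  | one => True
  | bot => True
  | tensor A B => inFLei A ∧ inFLei B
  | limp A B => inFLei A ∧ inFLei B
  | and A B => inFLei A ∧ inFLei B
  | or A B => inFLei A ∧ inFLei B
  | _ => False

/-- {⊗,⊸,&,⊕,1}-formulas -/
def inFLeiP : IForm → Prop
  | var _ => True
  | one => True
  | tensor A B => inFLeiP A ∧ inFLeiP B
  | limp A B => inFLeiP A ∧ inFLeiP B
  | and A B => inFLeiP A ∧ inFLeiP B
  | or A B => inFLeiP A ∧ inFLeiP B
  | _ => False

/-- purely implicational ({⊸}-) formulas -/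
def inImp : IForm → Prop
  | var _ => True
  | limp A B => inImp A ∧ inImp B
  | _ => False

/-- {⊸,!}-formulas -/
def inImpBang : IForm → Prop
  | var _ => True
  | limp A B => inImpBang A ∧ inImpBang B
  | bang A => inImpBang A
  | _ => False

/-- {⊸,!,§}-formulas: the language of ILAL -/
def inLAL : IForm → Prop
  | var _ => True
  | limp A B => inLAL A ∧ inLAL B
  | bang A => inLAL A
  | para A => inLAL A
  | _ => False

end IForm

/-- A parametrized intuitionistic sequent calculus: `K` is the set of allowed
formulas (the fragment), `ax` the set of non-logical axioms, and the remaining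
fields tell which optional rules are available. -/
structure ICalc where
  K : IForm → Prop
  ax : Set IForm
  wL : Prop      -- unrestricted left weakening (W)
  wR : Prop      -- right weakening (W')
  bD : Prop      -- dereliction (!D)
  bP : Prop      -- promotion (!P)
  bF : Prop      -- functorial promotion (!F)
  bW : Prop      -- !-weakening (!W), for linear systems
  lB : Prop      -- the ILAL rule (!)
  lP : Prop      -- the ILAL rule (§)

/-- Provability of an intuitionistic sequent `Γ ⊢ X` (X a stoup) in the
parametrized calculus `C`. -/
inductive IPrv (C : ICalc) : Multiset IForm → Option IForm → Prop where
  | axiom' {B} : B ∈ C.ax → IPrv C 0 (some B)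
  | init {A} : C.K A → IPrv C {A} (some A)
  | oneR : C.K .one → IPrv C 0 (some .one)
  | botL : C.K .bot → IPrv C {.bot} none
  | topR {Γ} : C.K .top → (∀ A ∈ Γ, C.K A) → IPrv C Γ (some .top)
  | zeroL {Γ X} : C.K .zero → (∀ A ∈ Γ, C.K A) → (∀ A, X = some A → C.K A) →
      IPrv C (.zero ::ₘ Γ) X
  | cut {Γ Δ X A} : IPrv C Γ (some A) → IPrv C (A ::ₘ Δ) X → IPrv C (Γ + Δ) X
  | oneL {Γ X} : C.K .one → IPrv C Γ X → IPrv C (.one ::ₘ Γ) X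
  | botR {Γ} : C.K .bot → IPrv C Γ none → IPrv C Γ (some .bot)
  | limpL {Γ Δ X A B} : C.K (.limp A B) → IPrv C Γ (some A) → IPrv C (B ::ₘ Δ) X →
      IPrv C (.limp A B ::ₘ (Γ + Δ)) X
  | limpR {Γ A B} : C.K (.limp A B) → IPrv C (A ::ₘ Γ) (some B) →
      IPrv C Γ (some (.limp A B))
  | tensorL {Γ X A B} : C.K (.tensor A B) → IPrv C (A ::ₘ B ::ₘ Γ) X →
      IPrv C (.tensor A B ::ₘ Γ) X
  | tensorR {Γ Δ A B} : C.K (.tensor A B) → IPrv C Γ (some A) → IPrv C Δ (some B) →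
      IPrv C (Γ + Δ) (some (.tensor A B))
  | withL1 {Γ X A B} : C.K (.and A B) → IPrv C (A ::ₘ Γ) X → IPrv C (.and A B ::ₘ Γ) X
  | withL2 {Γ X A B} : C.K (.and A B) → IPrv C (B ::ₘ Γ) X → IPrv C (.and A B ::ₘ Γ) X
  | withR {Γ A B} : C.K (.and A B) → IPrv C Γ (some A) → IPrv C Γ (some B) →
      IPrv C Γ (some (.and A B))
  | plusL {Γ X A B} : C.K (.or A B) → IPrv C (A ::ₘ Γ) X → IPrv C (B ::ₘ Γ) X →
      IPrv C (.or A B ::ₘ Γ) X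
  | plusR1 {Γ A B} : C.K (.or A B) → IPrv C Γ (some A) → IPrv C Γ (some (.or A B))
  | plusR2 {Γ A B} : C.K (.or A B) → IPrv C Γ (some B) → IPrv C Γ (some (.or A B))
  | bangD {Γ X A} : C.bD → C.K (.bang A) → IPrv C (A ::ₘ Γ) X → IPrv C (.bang A ::ₘ Γ) X
  | bangP {Γ : Multiset IForm} {A} : C.bP → C.K (.bang A) → (∀ B ∈ Γ, C.K (.bang B)) →
      IPrv C (Γ.map .bang) (some A) → IPrv C (Γ.map .bang) (some (.bang A))
  | bangF {Γ : Multiset IForm} {A} : C.bF → C.K (.bang A) → (∀ B ∈ Γ, C.K (.bang B)) →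
      IPrv C Γ (some A) → IPrv C (Γ.map .bang) (some (.bang A))
  | weakL {Γ X A} : C.wL → C.K A → IPrv C Γ X → IPrv C (A ::ₘ Γ) X
  | bangW {Γ X A} : C.bW → C.K (.bang A) → IPrv C Γ X → IPrv C (.bang A ::ₘ Γ) X
  | bangC {Γ X A} : C.K (.bang A) → IPrv C (.bang A ::ₘ .bang A ::ₘ Γ) X →
      IPrv C (.bang A ::ₘ Γ) X
  | weakR {Γ A} : C.wR → C.K A → IPrv C Γ none → IPrv C Γ (some A)
  | lalBang {A} {E : Multiset IForm} : C.lB → C.K (.bang A) →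
      (∀ B ∈ E, C.K (.bang B)) → Multiset.card E ≤ 1 → IPrv C E (some A) →
      IPrv C (E.map .bang) (some (.bang A))
  | lalPara {Γ Δ : Multiset IForm} {A} : C.lP → C.K (.para A) → (∀ B ∈ Γ, C.K (.bang B)) →
      (∀ B ∈ Δ, C.K (.para B)) → IPrv C (Γ + Δ) (some A) →
      IPrv C (Γ.map .bang + Δ.map .para) (some (.para A))

/-- ILZW with a set of non-logical axioms. -/
def ILZWc (Φ : Set IForm) : ICalc :=
  ⟨IForm.inL, Φ, True, False, True, True, False, False, False, False⟩

/-- ILZW' = ILZW + right weakening, with a set of non-logical axioms. -/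
def ILZWpc (Φ : Set IForm) : ICalc :=
  ⟨IForm.inL, Φ, True, True, True, True, False, False, False, False⟩

/-- ILLW: the ⊥-free fragment of ILZW. -/
def ILLWc (Φ : Set IForm) : ICalc :=
  ⟨IForm.inLp, Φ, True, False, True, True, False, False, False, False⟩

/-- IEZW: intuitionistic elementary affine logic with bottom. -/
def IEZWc (Φ : Set IForm) : ICalc :=
  ⟨IForm.inL, Φ, True, False, False, False, True, False, False, False⟩

/-- IELW: the ⊥-free fragment of IEZW. -/
def IELWc (Φ : Set IForm) : ICalc :=
  ⟨IForm.inLp, Φ, True, False, False, False, True, False, False, False⟩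

/-- FLei: the {⊗,⊸,&,⊕,1,⊥}-fragment of ILZW. -/
def FLeic (Φ : Set IForm) : ICalc :=
  ⟨IForm.inFLei, Φ, True, False, True, True, False, False, False, False⟩

/-- FLew: the {⊗,⊸,&,⊕,1,⊥}-fragment of ILZW'. -/
def FLewc (Φ : Set IForm) : ICalc :=
  ⟨IForm.inFLei, Φ, True, True, True, True, False, False, False, False⟩

/-- FLei⁺: the {⊗,⊸,&,⊕,1}-fragment of ILZW. -/
def FLeiPc (Φ : Set IForm) : ICalc :=
  ⟨IForm.inFLeiP, Φ, True, False, True, True, False, False, False, False⟩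

/-- BCK: the {⊸}-fragment of ILZW. -/
def BCKc (Φ : Set IForm) : ICalc :=
  ⟨IForm.inImp, Φ, True, False, True, True, False, False, False, False⟩

/-- The {⊸,!}-fragment of ILLW. -/
def ImpBangILLWc (Φ : Set IForm) : ICalc :=
  ⟨IForm.inImpBang, Φ, True, False, True, True, False, False, False, False⟩

/-- ILL: intuitionistic linear logic (no unrestricted weakening, only !W). -/
def ILLc (Φ : Set IForm) : ICalc :=
  ⟨IForm.inLp, Φ, False, False, True, True, False, True, False, False⟩

/-- BCI: the {⊸}-fragment of ILL. -/
def BCIc (Φ : Set IForm) : ICalc :=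
  ⟨IForm.inImp, Φ, False, False, True, True, False, True, False, False⟩

/-- ILAL: intuitionistic light affine logic. -/
def ILALc (Φ : Set IForm) : ICalc :=
  ⟨IForm.inLAL, Φ, True, False, False, False, False, False, True, True⟩

/-- Classical formulas: literals p, p⊥ and the connectives ⊗, ⅋, &, ⊕, 1, ⊥, ⊤, 0, !, ?. -/
inductive CForm : Type where
  | pos (n : ℕ)
  | neg (n : ℕ)
  | one
  | bot
  | top
  | zero
  | tensor (A B : CForm)
  | par (A B : CForm)
  | and (A B : CForm)
  | or (A B : CForm)
  | bang (A : CForm)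
  | quest (A : CForm)

namespace CForm

/-- De Morgan (involutive) negation. -/
def dual : CForm → CForm
  | pos n => neg n
  | neg n => pos n
  | one => bot
  | bot => one
  | top => zero
  | zero => top
  | tensor A B => par A.dual B.dual
  | par A B => tensor A.dual B.dual
  | and A B => or A.dual B.dual
  | or A B => and A.dual B.dual
  | bang A => quest A.dual
  | quest A => bang A.dual

/-- the propositional variable `x` occurs in the formula -/
def hasVar (x : ℕ) : CForm → Prop
  | pos n => n = x
  | neg n => n = x
  | one => False
  | bot => False
  | top => False
  | zero => False
  | tensor A B => hasVar x A ∨ hasVar x B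
  | par A B => hasVar x A ∨ hasVar x B
  | and A B => hasVar x A ∨ hasVar x B
  | or A B => hasVar x A ∨ hasVar x B
  | bang A => hasVar x A
  | quest A => hasVar x A

/-- {⊗,⅋,&,⊕,1,⊥}-formulas (the language of InFLew) -/
def inMALL : CForm → Prop
  | pos _ => True
  | neg _ => True
  | one => True
  | bot => True
  | tensor A B => inMALL A ∧ inMALL B
  | par A B => inMALL A ∧ inMALL B
  | and A B => inMALL A ∧ inMALL B
  | or A B => inMALL A ∧ inMALL B
  | _ => False

end CForm

/-- A parametrized one-sided classical sequent calculus. -/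
structure CCalc where
  K : CForm → Prop
  ax : Set CForm
  wk : Prop      -- unrestricted weakening (W)
  der : Prop     -- dereliction (?)
  prom : Prop    -- promotion (!)
  funcF : Prop   -- the functorial rule (F) of ELLW
  qW : Prop      -- ?-weakening (?W), for LL

/-- Provability of a one-sided sequent `⊢ Γ` in the parametrized calculus `C`. -/
inductive CPrv (C : CCalc) : Multiset CForm → Prop where
  | axiom' {B} : B ∈ C.ax → CPrv C {B}
  | init {A} : C.K A → C.K A.dual → CPrv C {A, A.dual}
  | one : C.K .one → CPrv C {.one}
  | top {Γ} : C.K .top → (∀ A ∈ Γ, C.K A) → CPrv C (.top ::ₘ Γ)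
  | cut {Γ Δ A} : CPrv C (A ::ₘ Γ) → CPrv C (A.dual ::ₘ Δ) → CPrv C (Γ + Δ)
  | bot {Γ} : C.K .bot → CPrv C Γ → CPrv C (.bot ::ₘ Γ)
  | tensor {Γ Δ A B} : C.K (.tensor A B) → CPrv C (A ::ₘ Γ) → CPrv C (B ::ₘ Δ) →
      CPrv C (.tensor A B ::ₘ (Γ + Δ))
  | par {Γ A B} : C.K (.par A B) → CPrv C (A ::ₘ B ::ₘ Γ) → CPrv C (.par A B ::ₘ Γ)
  | with' {Γ A B} : C.K (.and A B) → CPrv C (A ::ₘ Γ) → CPrv C (B ::ₘ Γ) →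
      CPrv C (.and A B ::ₘ Γ)
  | plus1 {Γ A B} : C.K (.or A B) → CPrv C (A ::ₘ Γ) → CPrv C (.or A B ::ₘ Γ)
  | plus2 {Γ A B} : C.K (.or A B) → CPrv C (B ::ₘ Γ) → CPrv C (.or A B ::ₘ Γ)
  | der {Γ A} : C.der → C.K (.quest A) → CPrv C (A ::ₘ Γ) → CPrv C (.quest A ::ₘ Γ)
  | prom {Γ : Multiset CForm} {A} : C.prom → C.K (.bang A) → (∀ B ∈ Γ, C.K (.quest B)) →
      CPrv C (A ::ₘ Γ.map .quest) → CPrv C (.bang A ::ₘ Γ.map .quest)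
  | wk {Γ A} : C.wk → C.K A → CPrv C Γ → CPrv C (A ::ₘ Γ)
  | questW {Γ A} : C.qW → C.K (.quest A) → CPrv C Γ → CPrv C (.quest A ::ₘ Γ)
  | questC {Γ A} : C.K (.quest A) → CPrv C (.quest A ::ₘ .quest A ::ₘ Γ) →
      CPrv C (.quest A ::ₘ Γ)
  | funcF {Γ : Multiset CForm} {A} : C.funcF → C.K (.bang A) → (∀ B ∈ Γ, C.K (.quest B)) →
      CPrv C (A ::ₘ Γ) → CPrv C (.bang A ::ₘ Γ.map .quest)

/-- LLW: classical affine logic, with a set of non-logical axioms. -/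
def LLWc (Φ : Set CForm) : CCalc :=
  ⟨fun _ => True, Φ, True, True, True, False, False⟩

/-- ELLW: classical elementary affine logic. -/
def ELLWc (Φ : Set CForm) : CCalc :=
  ⟨fun _ => True, Φ, True, False, False, True, False⟩

/-- InFLew: the {⊗,⅋,&,⊕,1,⊥}-fragment of LLW. -/
def InFLewc (Φ : Set CForm) : CCalc :=
  ⟨CForm.inMALL, Φ, True, False, False, False, False⟩

/-- LL: classical linear logic (weakening restricted to ?W). -/
def LLc (Φ : Set CForm) : CCalc :=
  ⟨fun _ => True, Φ, False, True, True, False, True⟩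

/-- The translation (·)^[F] of classical formulas into intuitionistic formulas,
where ¬_F B := B ⊸ F. -/
def trF (F : IForm) : CForm → IForm
  | .pos n => .limp (.var n) F
  | .neg n => .var n
  | .one => .limp .one F
  | .bot => .one
  | .top => .zero
  | .zero => .limp .zero F
  | .tensor B C => .limp (.limp (trF F B) F) (trF F C)
  | .par B C => .limp (.limp (trF F B) (.limp (trF F C) F)) F
  | .and B C => .or (trF F B) (trF F C)
  | .or B C => .limp (.or (.limp (trF F B) F) (.limp (trF F C) F)) F
  | .bang B => .limp (.bang (.limp (trF F B) F)) F
  | .quest B => .bang (trF F B)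

/-- The embedding (·)̲ of ⊥-free intuitionistic formulas into classical formulas. -/
def emb : IForm → CForm
  | .var n => .pos n
  | .one => .one
  | .top => .top
  | .bot => .bot
  | .zero => .zero
  | .tensor A B => .tensor (emb A) (emb B)
  | .limp A B => .par (emb A).dual (emb B)
  | .and A B => .and (emb A) (emb B)
  | .or A B => .or (emb A) (emb B)
  | .bang A => .bang (emb A)
  | .para A => .bang (emb A)

end Affine

namespace Affine
open scoped Pointwise

section Orthogonality

variable {M : Type*} [AddCommMonoid M] (P : Set M)

/-- The orthogonal of `X` in the phase space on `M` with pole `P`. -/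
def orth (X : Set M) : Set M := {b | ∀ a ∈ X, a + b ∈ P}

variable {P}

theorem orth_anti {X Y : Set M} (h : X ⊆ Y) : orth P Y ⊆ orth P X :=
  fun _ hb a ha => hb a (h ha)

theorem subset_orth_orth (X : Set M) : X ⊆ orth P (orth P X) :=
  fun a ha b hb => by rw [add_comm]; exact hb a ha

theorem orth_orth_orth (X : Set M) : orth P (orth P (orth P X)) = orth P X :=
  Set.Subset.antisymm (orth_anti (subset_orth_orth X)) (subset_orth_orth _)

theorem orth_union (X Y : Set M) : orth P (X ∪ Y) = orth P X ∩ orth P Y := by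
  ext b
  simp only [orth, Set.mem_union, Set.mem_inter_iff, Set.mem_ofPred_eq, or_imp, forall_and]

theorem mem_orth_add {X Y : Set M} {b : M} :
    b ∈ orth P (X + Y) ↔ ∀ x ∈ X, ∀ y ∈ Y, x + y + b ∈ P := by
  constructor
  · intro h x hx y hy
    exact h _ (Set.add_mem_add hx hy)
  · rintro h _ ⟨x, hx, y, hy, rfl⟩
    exact h x hx y hy

theorem orth_orth_add_subset (X Y : Set M) :
    orth P (orth P X) + orth P (orth P Y) ⊆ orth P (orth P (X + Y)) := by
  rintro _ ⟨a, ha, b, hb, rfl⟩ c hc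
  have h1 : ∀ x ∈ X, x + c ∈ orth P Y := fun x hx y hy => by
    have := mem_orth_add.1 hc x hx y hy
    rwa [add_comm x y, add_assoc] at this
  have h2 : b + c ∈ orth P X := fun x hx => by
    have := hb _ (h1 x hx)
    rwa [add_assoc, add_comm c b] at this
  have h3 := ha _ h2
  have e : c + (a + b) = b + c + a := by abel
  change c + (a + b) ∈ P
  rwa [e]

theorem orth_orth_inter {X Y : Set M} (hX : orth P (orth P X) = X)
    (hY : orth P (orth P Y) = Y) : orth P (orth P (X ∩ Y)) = X ∩ Y := by
  rw [← hX, ← hY, ← orth_union, orth_orth_orth]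

theorem orth_add_orth_orth {X Y : Set M} :
    orth P (orth P (orth P X) + orth P (orth P Y)) = orth P (X + Y) := by
  apply Set.Subset.antisymm
  · exact orth_anti (Set.add_subset_add (subset_orth_orth X) (subset_orth_orth Y))
  · rw [← orth_orth_orth (X + Y)]
    exact orth_anti (orth_orth_add_subset X Y)

end Orthogonality

namespace CForm

@[simp] theorem dual_dual (A : CForm) : A.dual.dual = A := by
  induction A <;> simp_all [dual]

end CForm

/-- A set of classical sequents closed under the cut-free rules of LL. -/
structure CutFreeClosed (P : Set (Multiset CForm)) : Prop where
  init (n : ℕ) : {.pos n, .neg n} ∈ P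
  one : {.one} ∈ P
  top (Γ) : .top ::ₘ Γ ∈ P
  bot {Γ} : Γ ∈ P → .bot ::ₘ Γ ∈ P
  tensor {Γ Δ A B} : A ::ₘ Γ ∈ P → B ::ₘ Δ ∈ P → .tensor A B ::ₘ (Γ + Δ) ∈ P
  par {Γ A B} : A ::ₘ B ::ₘ Γ ∈ P → .par A B ::ₘ Γ ∈ P
  and {Γ A B} : A ::ₘ Γ ∈ P → B ::ₘ Γ ∈ P → .and A B ::ₘ Γ ∈ P
  or_left {Γ A B} : A ::ₘ Γ ∈ P → .or A B ::ₘ Γ ∈ P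
  or_right {Γ A B} : B ::ₘ Γ ∈ P → .or A B ::ₘ Γ ∈ P
  der {Γ A} : A ::ₘ Γ ∈ P → .quest A ::ₘ Γ ∈ P
  prom {Γ : Multiset CForm} {A} : A ::ₘ Γ.map .quest ∈ P → .bang A ::ₘ Γ.map .quest ∈ P
  weak {Γ A} : Γ ∈ P → .quest A ::ₘ Γ ∈ P
  contr {Γ A} : .quest A ::ₘ .quest A ::ₘ Γ ∈ P → .quest A ::ₘ Γ ∈ P

/-- Sequents consisting of `?`-formulas. -/
def questSeqs : Set (Multiset CForm) := Set.range (Multiset.map .quest)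

/-- The phase semantics of classical formulas in the syntactic phase space with pole `P`. -/
def phaseVal (P : Set (Multiset CForm)) : CForm → Set (Multiset CForm)
  | .pos n => orth P {{.pos n}}
  | .neg n => orth P (orth P {{.pos n}})
  | .one => orth P (orth P {0})
  | .bot => orth P {0}
  | .top => Set.univ
  | .zero => orth P Set.univ
  | .tensor A B => orth P (orth P (phaseVal P A + phaseVal P B))
  | .par A B => orth P (orth P (phaseVal P A) + orth P (phaseVal P B))
  | .and A B => phaseVal P A ∩ phaseVal P B
  | .or A B => orth P (orth P (phaseVal P A ∪ phaseVal P B))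
  | .bang A => orth P (orth P (questSeqs ∩ phaseVal P A))
  | .quest A => orth P (questSeqs ∩ orth P (phaseVal P A))

/-- The sequents obtained by replacing each formula of `Γ` by an element of the orthogonal of
its phase semantics. -/
def counterVal (P : Set (Multiset CForm)) (Γ : Multiset CForm) : Set (Multiset CForm) :=
  (Γ.map fun A => orth P (phaseVal P A)).sum

section PhaseSemantics

variable {P : Set (Multiset CForm)}

theorem orth_orth_phaseVal (A : CForm) : orth P (orth P (phaseVal P A)) = phaseVal P A := by
  induction A with
  | and A B ihA ihB => exact orth_orth_inter ihA ihB
  | top => exact Set.Subset.antisymm (Set.subset_univ _) (subset_orth_orth _)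
  | _ => simp only [phaseVal, orth_orth_orth]

theorem phaseVal_dual (A : CForm) : phaseVal P A.dual = orth P (phaseVal P A) := by
  induction A with
  | pos n => rfl
  | neg n => simp only [CForm.dual, phaseVal, orth_orth_orth]
  | one => simp only [CForm.dual, phaseVal, orth_orth_orth]
  | bot => rfl
  | top => rfl
  | zero => exact (orth_orth_phaseVal (P := P) .top).symm
  | tensor A B ihA ihB =>
    simp only [CForm.dual, phaseVal, ihA, ihB, orth_add_orth_orth, orth_orth_orth]
  | par A B ihA ihB => simp only [CForm.dual, phaseVal, ihA, ihB]
  | and A B ihA ihB =>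
    simp only [CForm.dual, phaseVal, ihA, ihB, orth_union, orth_orth_phaseVal]
  | or A B ihA ihB =>
    simp only [CForm.dual, phaseVal, ihA, ihB, ← orth_union, orth_orth_orth]
  | bang A ih => simp only [CForm.dual, phaseVal, ih, orth_orth_phaseVal, orth_orth_orth]
  | quest A ih => simp only [CForm.dual, phaseVal, ih]

theorem CutFreeClosed.cons_mem_of_mem_phaseVal (hP : CutFreeClosed P) (A : CForm) :
    ∀ Γ ∈ phaseVal P A, A ::ₘ Γ ∈ P := by
  have key : ∀ (X : Set (Multiset CForm)) (A : CForm), (∀ Γ ∈ X, A ::ₘ Γ ∈ P) →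
      ∀ Γ ∈ orth P (orth P X), A ::ₘ Γ ∈ P := fun X A h Γ hΓ =>
    hΓ {A} fun a ha => by
      rw [add_comm]
      exact h a ha
  have self : ∀ A : CForm, (∀ Γ ∈ phaseVal P A, A ::ₘ Γ ∈ P) →
      {A} ∈ orth P (phaseVal P A) := fun A h a ha => by
    rw [add_comm]
    exact h a ha
  induction A with
  | pos n => exact fun Γ hΓ => hΓ _ rfl
  | neg n =>
    intro Γ hΓ
    exact hΓ {.neg n} (by rintro _ rfl; exact hP.init n)
  | one => exact key _ _ (by rintro _ rfl; exact hP.one)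
  | bot =>
    intro Γ hΓ
    have := hΓ 0 rfl
    rw [zero_add] at this
    exact hP.bot this
  | top => exact fun Γ _ => hP.top Γ
  | zero =>
    intro Γ hΓ
    exact hΓ {.zero} trivial
  | tensor A B ihA ihB =>
    apply key
    rintro _ ⟨a, ha, b, hb, rfl⟩
    exact hP.tensor (ihA a ha) (ihB b hb)
  | par A B ihA ihB =>
    intro Γ hΓ
    have := mem_orth_add.1 hΓ _ (self A ihA) _ (self B ihB)
    rw [add_assoc] at this
    exact hP.par this
  | and A B ihA ihB => exact fun Γ hΓ => hP.and (ihA Γ hΓ.1) (ihB Γ hΓ.2)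
  | or A B ihA ihB =>
    apply key
    rintro Γ (h | h)
    · exact hP.or_left (ihA Γ h)
    · exact hP.or_right (ihB Γ h)
  | bang A ih =>
    apply key
    rintro _ ⟨⟨Γ, rfl⟩, h⟩
    exact hP.prom (ih _ h)
  | quest A ih =>
    intro Γ hΓ
    refine hΓ {.quest A} ⟨⟨{A}, by simp⟩, fun a ha => ?_⟩
    rw [add_comm]
    exact hP.der (ih a ha)

theorem CutFreeClosed.self_mem_counterVal (hP : CutFreeClosed P) (Γ : Multiset CForm) :
    Γ ∈ counterVal P Γ := by
  induction Γ using Multiset.induction with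
  | empty => exact Set.mem_zero.2 rfl
  | cons A Γ ih =>
    rw [counterVal, Multiset.map_cons, Multiset.sum_cons, ← Multiset.singleton_add]
    refine Set.add_mem_add (fun a ha => ?_) ih
    rw [add_comm]
    exact hP.cons_mem_of_mem_phaseVal A a ha

theorem CutFreeClosed.weak_questSeqs (hP : CutFreeClosed P) {Γ j : Multiset CForm}
    (hj : j ∈ questSeqs) (h : Γ ∈ P) : j + Γ ∈ P := by
  obtain ⟨Δ, rfl⟩ := hj
  induction Δ using Multiset.induction with
  | empty => simpa using h
  | cons A Δ ih =>
    rw [Multiset.map_cons, Multiset.cons_add]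
    exact hP.weak ih

theorem CutFreeClosed.contr_questSeqs (hP : CutFreeClosed P) {Γ j : Multiset CForm}
    (hj : j ∈ questSeqs) (h : j + (j + Γ) ∈ P) : j + Γ ∈ P := by
  obtain ⟨Δ, rfl⟩ := hj
  induction Δ using Multiset.induction generalizing Γ with
  | empty => simpa using h
  | cons A Δ ih =>
    simp only [Multiset.map_cons, Multiset.cons_add, Multiset.add_cons] at h ⊢
    have h' := hP.contr h
    rw [← Multiset.add_cons, ← Multiset.add_cons] at h'
    simpa only [Multiset.add_cons] using ih h'

theorem counterVal_cons (A : CForm) (Γ : Multiset CForm) :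
    counterVal P (A ::ₘ Γ) = orth P (phaseVal P A) + counterVal P Γ := by
  simp only [counterVal, Multiset.map_cons, Multiset.sum_cons]

theorem counterVal_add (Γ Δ : Multiset CForm) :
    counterVal P (Γ + Δ) = counterVal P Γ + counterVal P Δ := by
  simp only [counterVal, Multiset.map_add, Multiset.sum_add]

theorem counterVal_zero : counterVal P 0 = {0} := rfl

theorem counterVal_cons_subset_iff (A : CForm) (Γ : Multiset CForm) :
    counterVal P (A ::ₘ Γ) ⊆ P ↔ counterVal P Γ ⊆ phaseVal P A := by
  rw [counterVal_cons]
  constructor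
  · intro h γ hγ
    rw [← orth_orth_phaseVal]
    exact fun a ha => h (Set.add_mem_add ha hγ)
  · rintro h _ ⟨a, ha, γ, hγ, rfl⟩
    have := ha γ (h hγ)
    rwa [add_comm] at this

theorem counterVal_map_quest_subset (Γ : Multiset CForm) :
    counterVal P (Γ.map .quest) ⊆ orth P (orth P (questSeqs ∩ counterVal P (Γ.map .quest))) := by
  induction Γ using Multiset.induction with
  | empty =>
    refine Set.Subset.trans ?_ (subset_orth_orth _)
    rintro γ hγ
    refine ⟨⟨0, ?_⟩, hγ⟩
    exact hγ.symm
  | cons A Γ ih =>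
    rw [Multiset.map_cons, counterVal_cons]
    refine (Set.add_subset_add_left ih).trans ?_
    refine (orth_orth_add_subset (questSeqs ∩ orth P (phaseVal P A)) _).trans ?_
    refine orth_anti (orth_anti ?_)
    rintro _ ⟨_, ⟨⟨Δ, rfl⟩, ha⟩, _, ⟨⟨Θ, rfl⟩, hb⟩, rfl⟩
    refine ⟨⟨Δ + Θ, Multiset.map_add _ _ _⟩, Set.add_mem_add ?_ hb⟩
    exact subset_orth_orth (questSeqs ∩ orth P (phaseVal P A)) ⟨⟨Δ, rfl⟩, ha⟩

theorem CutFreeClosed.counterVal_subset (hP : CutFreeClosed P) {Γ : Multiset CForm}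
    (h : CPrv (LLc ∅) Γ) : counterVal P Γ ⊆ P := by
  induction h with
  | axiom' h => exact h.elim
  | @init A _ _ =>
    refine (counterVal_cons_subset_iff _ _).2 ?_
    rw [← Multiset.cons_zero, counterVal_cons, counterVal_zero, phaseVal_dual,
      orth_orth_phaseVal]
    rintro _ ⟨a, ha, _, rfl, rfl⟩
    simpa using ha
  | one =>
    refine (counterVal_cons_subset_iff _ _).2 ?_
    exact subset_orth_orth _
  | top _ _ => exact (counterVal_cons_subset_iff _ _).2 (Set.subset_univ _)
  | @cut Γ Δ A _ _ ih1 ih2 =>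
    rw [counterVal_cons_subset_iff] at ih1 ih2
    rw [phaseVal_dual] at ih2
    rw [counterVal_add]
    rintro _ ⟨γ, hγ, δ, hδ, rfl⟩
    exact ih2 hδ γ (ih1 hγ)
  | bot _ _ ih =>
    refine (counterVal_cons_subset_iff _ _).2 fun γ hγ => ?_
    rintro _ rfl
    rw [zero_add]
    exact ih hγ
  | tensor _ _ _ ih1 ih2 =>
    rw [counterVal_cons_subset_iff] at ih1 ih2 ⊢
    rw [counterVal_add]
    exact (Set.add_subset_add ih1 ih2).trans (subset_orth_orth _)
  | par _ _ ih =>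
    refine (counterVal_cons_subset_iff _ _).2 fun γ hγ => mem_orth_add.2 fun a ha b hb => ?_
    rw [add_assoc]
    refine ih ?_
    rw [counterVal_cons, counterVal_cons]
    exact Set.add_mem_add ha (Set.add_mem_add hb hγ)
  | with' _ _ _ ih1 ih2 =>
    rw [counterVal_cons_subset_iff] at ih1 ih2 ⊢
    exact Set.subset_inter ih1 ih2
  | plus1 _ _ ih =>
    rw [counterVal_cons_subset_iff] at ih ⊢
    exact (ih.trans Set.subset_union_left).trans (subset_orth_orth _)
  | plus2 _ _ ih =>
    rw [counterVal_cons_subset_iff] at ih ⊢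
    exact (ih.trans Set.subset_union_right).trans (subset_orth_orth _)
  | der _ _ _ ih =>
    refine (counterVal_cons_subset_iff _ _).2 fun γ hγ j hj => ih ?_
    rw [counterVal_cons]
    exact Set.add_mem_add hj.2 hγ
  | prom _ _ _ _ ih =>
    rw [counterVal_cons_subset_iff] at ih ⊢
    refine (counterVal_map_quest_subset _).trans (orth_anti (orth_anti ?_))
    exact Set.inter_subset_inter_right _ ih
  | wk h => exact h.elim
  | questW _ _ _ ih =>
    exact (counterVal_cons_subset_iff _ _).2 fun γ hγ j hj => hP.weak_questSeqs hj.1 (ih hγ)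
  | questC _ _ ih =>
    refine (counterVal_cons_subset_iff _ _).2 fun γ hγ j hj =>
      hP.contr_questSeqs hj.1 (ih ?_)
    rw [counterVal_cons, counterVal_cons]
    have hj' := subset_orth_orth (P := P) _ hj
    exact Set.add_mem_add hj' (Set.add_mem_add hj' hγ)
  | funcF h => exact h.elim

/-- A set of sequents closed under the cut-free rules of LL contains all sequents provable in LL
(with cut). -/
theorem CutFreeClosed.mem_of_provable (hP : CutFreeClosed P) {Γ : Multiset CForm}
    (h : CPrv (LLc ∅) Γ) : Γ ∈ P :=
  hP.counterVal_subset h (hP.self_mem_counterVal Γ)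

end PhaseSemantics

section ToILL

variable {F : IForm} {Γ Δ : Multiset IForm} {A B : IForm}

theorem inLp_trF (hF : F.inLp) (A : CForm) : (trF F A).inLp := by
  induction A <;> simp_all [trF, IForm.inLp]

theorem IPrv.neg_left (hF : F.inLp) (hA : A.inLp) (h : IPrv (ILLc ∅) Γ (some A)) :
    IPrv (ILLc ∅) (.limp A F ::ₘ Γ) (some F) := by
  have := IPrv.limpL (C := ILLc ∅) (B := F) (Δ := 0) ⟨hA, hF⟩ h (IPrv.init hF)
  rwa [add_zero] at this

theorem IPrv.neg_right (hF : F.inLp) (hA : A.inLp) (h : IPrv (ILLc ∅) (A ::ₘ Γ) (some F)) :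
    IPrv (ILLc ∅) Γ (some (.limp A F)) :=
  IPrv.limpR ⟨hA, hF⟩ h

/-- The sequents whose translation is provable in ILL are closed under the cut-free rules
of LL. -/
theorem cutFreeClosed_trF (hF : F.inLp) :
    CutFreeClosed {Γ | IPrv (ILLc ∅) (Γ.map (trF F)) (some F)} where
  init n := by
    simp only [Set.mem_ofPred_eq, Multiset.insert_eq_cons, Multiset.map_cons,
      Multiset.map_singleton, trF]
    exact IPrv.neg_left hF trivial (IPrv.init trivial)
  one := IPrv.neg_left (Γ := 0) hF trivial (IPrv.oneR trivial)
  top Γ := by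
    simp only [Set.mem_ofPred_eq, Multiset.map_cons, trF]
    refine IPrv.zeroL trivial ?_ ?_
    · intro A hA
      obtain ⟨B, -, rfl⟩ := Multiset.mem_map.1 hA
      exact inLp_trF hF B
    · rintro _ ⟨⟩
      exact hF
  bot h := by
    simp only [Set.mem_ofPred_eq, Multiset.map_cons, trF]
    exact IPrv.oneL trivial h
  tensor {Γ Δ A B} h1 h2 := by
    have hA := inLp_trF hF A
    have hB := inLp_trF hF B
    simp only [Set.mem_ofPred_eq, Multiset.map_cons, Multiset.map_add, trF] at h1 h2 ⊢
    exact IPrv.limpL ⟨⟨hA, hF⟩, hB⟩ (IPrv.neg_right hF hA h1) h2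
  par {Γ A B} h := by
    have hA := inLp_trF hF A
    have hB := inLp_trF hF B
    simp only [Set.mem_ofPred_eq, Multiset.map_cons, trF] at h ⊢
    refine IPrv.neg_left hF ⟨hA, hB, hF⟩ (IPrv.limpR ⟨hA, hB, hF⟩ (IPrv.neg_right hF hB ?_))
    rwa [Multiset.cons_swap]
  and {Γ A B} h1 h2 := by
    simp only [Set.mem_ofPred_eq, Multiset.map_cons, trF] at h1 h2 ⊢
    exact IPrv.plusL ⟨inLp_trF hF A, inLp_trF hF B⟩ h1 h2
  or_left {Γ A B} h := by
    have hA := inLp_trF hF A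
    have hB := inLp_trF hF B
    simp only [Set.mem_ofPred_eq, Multiset.map_cons, trF] at h ⊢
    exact IPrv.neg_left hF ⟨⟨hA, hF⟩, hB, hF⟩
      (IPrv.plusR1 ⟨⟨hA, hF⟩, hB, hF⟩ (IPrv.neg_right hF hA h))
  or_right {Γ A B} h := by
    have hA := inLp_trF hF A
    have hB := inLp_trF hF B
    simp only [Set.mem_ofPred_eq, Multiset.map_cons, trF] at h ⊢
    exact IPrv.neg_left hF ⟨⟨hA, hF⟩, hB, hF⟩
      (IPrv.plusR2 ⟨⟨hA, hF⟩, hB, hF⟩ (IPrv.neg_right hF hB h))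
  der {Γ A} h := by
    simp only [Set.mem_ofPred_eq, Multiset.map_cons, trF] at h ⊢
    exact IPrv.bangD trivial (inLp_trF hF A) h
  prom {Γ A} h := by
    have hA := inLp_trF hF A
    have e : (Γ.map .quest).map (trF F) = (Γ.map (trF F)).map .bang := by
      simp only [Multiset.map_map, Function.comp_def, trF]
    simp only [Set.mem_ofPred_eq, Multiset.map_cons, e] at h ⊢
    refine IPrv.neg_left hF (A := .bang _) ⟨hA, hF⟩
      (IPrv.bangP trivial ⟨hA, hF⟩ ?_ (IPrv.neg_right hF hA h))
    intro B hB
    obtain ⟨C, -, rfl⟩ := Multiset.mem_map.1 hB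
    exact inLp_trF hF C
  weak {Γ A} h := by
    simp only [Set.mem_ofPred_eq, Multiset.map_cons, trF] at h ⊢
    exact IPrv.bangW trivial (inLp_trF hF A) h
  contr {Γ A} h := by
    simp only [Set.mem_ofPred_eq, Multiset.map_cons, trF] at h ⊢
    exact IPrv.bangC (inLp_trF hF A) h

end ToILL

section ToLL

/-- The embedding `emb` followed by the substitution of `⊥` for the variable `x`. -/
def embBot (x : ℕ) : IForm → CForm
  | .var n => if n = x then .bot else .pos n
  | .one => .one
  | .top => .top
  | .bot => .bot
  | .zero => .zero
  | .tensor A B => .tensor (embBot x A) (embBot x B)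
  | .limp A B => .par (embBot x A).dual (embBot x B)
  | .and A B => .and (embBot x A) (embBot x B)
  | .or A B => .or (embBot x A) (embBot x B)
  | .bang A => .bang (embBot x A)
  | .para A => .bang (embBot x A)

/-- The one-sided classical sequent embedding an intuitionistic sequent, with `⊥` for `x`. -/
def embSeq (x : ℕ) (Γ : Multiset IForm) (X : Option IForm) : Multiset CForm :=
  Γ.map (fun A => (embBot x A).dual) + X.elim 0 fun A => {embBot x A}

theorem CPrv.swap {C : CCalc} {Γ : Multiset CForm} {A B : CForm}
    (h : CPrv C (A ::ₘ B ::ₘ Γ)) : CPrv C (B ::ₘ A ::ₘ Γ) := by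
  rwa [Multiset.cons_swap]

variable (x : ℕ)

theorem embSeq_cons (A : IForm) (Γ : Multiset IForm) (X : Option IForm) :
    embSeq x (A ::ₘ Γ) X = (embBot x A).dual ::ₘ embSeq x Γ X := by
  simp only [embSeq, Multiset.map_cons, Multiset.cons_add]

theorem embSeq_some (A : IForm) (Γ : Multiset IForm) :
    embSeq x Γ (some A) = embBot x A ::ₘ Γ.map fun A => (embBot x A).dual := by
  simp only [embSeq, Option.elim, add_comm _ {embBot x A}, Multiset.singleton_add]

theorem embSeq_add (Γ Δ : Multiset IForm) (X : Option IForm) :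
    embSeq x (Γ + Δ) X = Γ.map (fun A => (embBot x A).dual) + embSeq x Δ X := by
  simp only [embSeq, Multiset.map_add, add_assoc]

theorem CPrv.embSeq_of_ILL {Γ : Multiset IForm} {X : Option IForm} (h : IPrv (ILLc ∅) Γ X) :
    CPrv (LLc ∅) (embSeq x Γ X) := by
  induction h with
  | axiom' h => exact h.elim
  | @init A _ =>
    rw [embSeq_some]
    exact CPrv.init trivial trivial
  | oneR _ => exact CPrv.one trivial
  | botL h => exact h.elim
  | topR _ _ =>
    rw [embSeq_some]
    exact CPrv.top trivial fun _ _ => trivial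
  | zeroL _ _ _ =>
    rw [embSeq_cons]
    exact CPrv.top trivial fun _ _ => trivial
  | cut _ _ ih1 ih2 =>
    rw [embSeq_some] at ih1
    rw [embSeq_cons] at ih2
    rw [embSeq_add]
    exact CPrv.cut ih1 ih2
  | oneL _ _ ih =>
    rw [embSeq_cons]
    exact CPrv.bot trivial ih
  | botR h => exact h.elim
  | limpL _ _ _ ih1 ih2 =>
    rw [embSeq_some] at ih1
    rw [embSeq_cons] at ih2
    rw [embSeq_cons, embSeq_add]
    simp only [embBot, CForm.dual, CForm.dual_dual]
    exact CPrv.tensor trivial ih1 ih2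
  | limpR _ _ ih =>
    rw [embSeq_cons, embSeq_some] at ih
    rw [embSeq_some]
    exact CPrv.par trivial ih
  | tensorL _ _ ih =>
    rw [embSeq_cons, embSeq_cons] at ih
    rw [embSeq_cons]
    exact CPrv.par trivial ih
  | tensorR _ _ _ ih1 ih2 =>
    rw [embSeq_some] at ih1 ih2 ⊢
    rw [Multiset.map_add]
    exact CPrv.tensor trivial ih1 ih2
  | withL1 _ _ ih =>
    rw [embSeq_cons] at ih ⊢
    exact CPrv.plus1 trivial ih
  | withL2 _ _ ih =>
    rw [embSeq_cons] at ih ⊢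
    exact CPrv.plus2 trivial ih
  | withR _ _ _ ih1 ih2 =>
    rw [embSeq_some] at ih1 ih2 ⊢
    exact CPrv.with' trivial ih1 ih2
  | plusL _ _ _ ih1 ih2 =>
    rw [embSeq_cons] at ih1 ih2 ⊢
    exact CPrv.with' trivial ih1 ih2
  | plusR1 _ _ ih =>
    rw [embSeq_some] at ih ⊢
    exact CPrv.plus1 trivial ih
  | plusR2 _ _ ih =>
    rw [embSeq_some] at ih ⊢
    exact CPrv.plus2 trivial ih
  | bangD _ _ _ ih =>
    rw [embSeq_cons] at ih ⊢
    exact CPrv.der trivial trivial ih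
  | @bangP Γ A _ _ _ _ ih =>
    have e : (Γ.map .bang).map (fun A => (embBot x A).dual) =
        (Γ.map fun A => (embBot x A).dual).map .quest := by
      simp only [Multiset.map_map, Function.comp_def, embBot, CForm.dual]
    rw [embSeq_some, e] at ih ⊢
    exact CPrv.prom trivial trivial (fun _ _ => trivial) ih
  | bangF h => exact h.elim
  | weakL h => exact h.elim
  | bangW _ _ _ ih =>
    rw [embSeq_cons]
    exact CPrv.questW trivial trivial ih
  | bangC _ _ ih =>
    rw [embSeq_cons, embSeq_cons] at ih
    rw [embSeq_cons]
    exact CPrv.questC trivial ih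
  | weakR h => exact h.elim
  | lalBang h => exact h.elim
  | lalPara h => exact h.elim

variable {Γ : Multiset CForm} {A B : CForm}

theorem CPrv.tensor_one (h : CPrv (LLc ∅) (A ::ₘ Γ)) :
    CPrv (LLc ∅) (.tensor A .one ::ₘ Γ) := by
  have := CPrv.tensor (C := LLc ∅) (Δ := 0) trivial h (CPrv.one trivial)
  rwa [add_zero] at this

theorem CPrv.par_bot (h : CPrv (LLc ∅) (A ::ₘ Γ)) : CPrv (LLc ∅) (.par A .bot ::ₘ Γ) :=
  CPrv.par trivial (CPrv.bot trivial h).swap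

theorem CPrv.trF_self (A : CForm) (hx : ¬ A.hasVar x) :
    CPrv (LLc ∅) (embBot x (trF (.var x) A) ::ₘ A ::ₘ 0) := by
  induction A with
  | pos n =>
    rw [CForm.hasVar] at hx
    simp only [trF, embBot, if_neg hx, if_true, CForm.dual]
    exact CPrv.par_bot (CPrv.init (A := .neg n) trivial trivial)
  | neg n =>
    rw [CForm.hasVar] at hx
    simp only [trF, embBot, if_neg hx]
    exact CPrv.init (A := .pos n) trivial trivial
  | one =>
    simp only [trF, embBot, if_true, CForm.dual]
    exact CPrv.par_bot (CPrv.init (A := .bot) trivial trivial)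
  | bot => exact CPrv.init (A := .one) trivial trivial
  | top => exact CPrv.init (A := .zero) trivial trivial
  | zero =>
    simp only [trF, embBot, if_true, CForm.dual]
    exact CPrv.par_bot (CPrv.init (A := .top) trivial trivial)
  | tensor A B ihA ihB =>
    rw [CForm.hasVar, not_or] at hx
    simp only [trF, embBot, if_true, CForm.dual, CForm.dual_dual]
    refine CPrv.par trivial ?_
    have := CPrv.tensor (C := LLc ∅) trivial (CPrv.tensor_one (ihA hx.1)).swap (ihB hx.2).swap
    rw [Multiset.cons_add, zero_add] at this
    have := this.swap
    rwa [Multiset.cons_swap (CForm.tensor A B)] at this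
  | par A B ihA ihB =>
    rw [CForm.hasVar, not_or] at hx
    simp only [trF, embBot, if_true, CForm.dual, CForm.dual_dual]
    refine CPrv.par_bot (CPrv.swap (CPrv.par trivial ?_))
    have := CPrv.tensor (C := LLc ∅) trivial (ihA hx.1) (CPrv.tensor_one (ihB hx.2))
    rw [Multiset.cons_add, zero_add] at this
    have := this.swap
    rwa [Multiset.cons_swap (CForm.tensor _ _)] at this
  | and A B ihA ihB =>
    rw [CForm.hasVar, not_or] at hx
    exact (CPrv.with' trivial (CPrv.plus1 trivial (ihA hx.1)).swap
      (CPrv.plus2 trivial (ihB hx.2)).swap).swap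
  | or A B ihA ihB =>
    rw [CForm.hasVar, not_or] at hx
    simp only [trF, embBot, if_true, CForm.dual, CForm.dual_dual]
    exact CPrv.par_bot (CPrv.with' trivial
      (CPrv.plus1 trivial (CPrv.tensor_one (ihA hx.1)).swap).swap
      (CPrv.plus2 trivial (CPrv.tensor_one (ihB hx.2)).swap).swap)
  | bang A ih =>
    simp only [trF, embBot, if_true, CForm.dual, CForm.dual_dual]
    refine CPrv.par_bot (CPrv.swap ?_)
    exact CPrv.prom (C := LLc ∅) (Γ := {_}) trivial trivial (fun _ _ => trivial)
      (CPrv.der trivial trivial (CPrv.tensor_one (ih hx))).swap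
  | quest A ih =>
    exact CPrv.prom (C := LLc ∅) (Γ := {A}) trivial trivial (fun _ _ => trivial)
      (CPrv.der trivial trivial (ih hx).swap).swap

theorem CPrv.of_embBot_trF (hx : ∀ A ∈ Γ, ¬ A.hasVar x) {Δ : Multiset CForm}
    (h : CPrv (LLc ∅) (Γ.map (fun A => (embBot x (trF (.var x) A)).dual) + Δ)) :
    CPrv (LLc ∅) (Γ + Δ) := by
  induction Γ using Multiset.induction generalizing Δ with
  | empty => simpa using h
  | cons A Γ ih =>
    rw [Multiset.map_cons, Multiset.cons_add] at h
    have := CPrv.cut (CPrv.trF_self x A (hx A (Multiset.mem_cons_self A Γ))) h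
    rw [Multiset.cons_add, zero_add, ← Multiset.add_cons] at this
    rw [Multiset.cons_add, ← Multiset.add_cons]
    exact ih (fun B hB => hx B (Multiset.mem_cons_of_mem hB)) this

end ToLL

/-- `⊢ Γ` is provable in LL iff `Γ^[x] ⊢ x` is provable in ILL,
for `x` a variable not occurring in `Γ`. -/
theorem ll_iff_ill_translation (Γ : Multiset CForm) (x : ℕ)
    (hx : ∀ A ∈ Γ, ¬ A.hasVar x) :
    CPrv (LLc ∅) Γ ↔
      IPrv (ILLc ∅) (Γ.map (trF (IForm.var x))) (some (IForm.var x)) := by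
  refine ⟨fun h => (cutFreeClosed_trF (F := .var x) trivial).mem_of_provable h, fun h => ?_⟩
  have h1 := CPrv.embSeq_of_ILL x h
  simp only [embSeq_some, embBot, if_true, Multiset.map_map, Function.comp_def] at h1
  have h2 := CPrv.cut h1 (CPrv.one (C := LLc ∅) trivial)
  exact add_zero Γ ▸ CPrv.of_embBot_trF x hx h2
end Affine
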